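/- There is a constant c depending only on n, R, d (not on C, C̃ or ν) such that for all ν ∈ ℤ^R, all integers q with 1 ≤ q ≤ C̃^R P^η, all a ∈ ℤ^R with 1 ≤ a_i ≤ q and gcd(a_1,…,a_R,q) = 1, and all α = a/q + β ∈ 𝔐_{a,q}(θ_0): |S(α, ν) − P^n q^{−n} S_{a,q}(ν) · I(𝓑, P^d β) · e(−β·ν)| ≤ c C C̃^{R−1} P^{n + η − 1}. -/

import Mathlib

open MeasureTheory Filter MvPolynomial

noncomputable section

/-- `e t = exp (2 π i t)` -/
def eC (t : ℝ) : ℂ := Complex.exp (2 * (Real.pi : ℂ) * Complex.I * (t : ℂ))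

abbrev Qbar : Type := AlgebraicClosure ℚ

/-- Dimension of the affine singular locus of `g` (the common zero set of the partial
derivatives of `g`), as the Krull dimension of its coordinate ring. -/
def singDim (n : ℕ) (g : MvPolynomial (Fin n) Qbar) : WithBot ℕ∞ :=
  ringKrullDim (MvPolynomial (Fin n) Qbar ⧸
    Ideal.span (Set.range fun j : Fin n => MvPolynomial.pderiv j g))

/-- `Δ = max_{b ∈ ℤ^R \ {0}} dim Sing(b₁ g₁ + ⋯ + b_R g_R)`. -/
def birchDelta (n R : ℕ) (g : Fin R → MvPolynomial (Fin n) ℤ) : WithBot ℕ∞ :=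
  ⨆ (b : Fin R → ℤ) (_ : b ≠ 0),
    singDim n (MvPolynomial.map (Int.castRingHom Qbar) (∑ i, b i • g i))

/-- `K = (n - Δ)/2^(d-1)` where `Δ = max_{b ≠ 0} dim Sing(f̃_b)`. -/
def KofDelta (n R d : ℕ) (g : Fin R → MvPolynomial (Fin n) ℤ) (K : ℝ) : Prop :=
  ∃ Δ : ℕ, ((Δ : ℕ∞) : WithBot ℕ∞) = birchDelta n R g ∧
    K = ((n : ℝ) - (Δ : ℝ)) / 2 ^ (d - 1)

/-- The quantity `R(R+1)(d-1)` as a real number. -/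
def BB (R d : ℕ) : ℝ := (R : ℝ) * ((R : ℝ) + 1) * ((d : ℝ) - 1)

/-- The `R × R` minor of the Jacobian matrix of `f` with columns given by the elements
of `I`. -/
def jacMinor {n R : ℕ} (f : Fin R → MvPolynomial (Fin n) ℤ)
    (I : Finset (Fin n)) (hI : I.card = R) : MvPolynomial (Fin n) ℤ :=
  Matrix.det (Matrix.of fun i k : Fin R => MvPolynomial.pderiv (I.orderEmbOfFin hI k) (f i))

/-- `Cv` is the maximum of the absolute values of the coefficients of the `f i`. -/
def coeffMax {n R : ℕ} (f : Fin R → MvPolynomial (Fin n) ℤ) (Cv : ℝ) : Prop :=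
  IsGreatest {x : ℝ | ∃ (i : Fin R) (m : (Fin n) →₀ ℕ), x = |((MvPolynomial.coeff m (f i) : ℤ) : ℝ)|} Cv

/-- The integer points of the dilated box `P𝓑`. -/
def boxPts {n : ℕ} (aB bB : Fin n → ℝ) (P : ℝ) : Finset (Fin n → ℤ) :=
  Finset.Icc (fun j => ⌈P * aB j⌉) (fun j => ⌊P * bB j⌋)

/-- The exponential sum `S(α) = ∑_{x ∈ P𝓑 ∩ ℤ^n} e(α · f(x))`. -/
def Sexp {n R : ℕ} (f : Fin R → MvPolynomial (Fin n) ℤ) (aB bB : Fin n → ℝ) (P : ℝ)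
    (α : Fin R → ℝ) : ℂ :=
  ∑ x ∈ boxPts aB bB P, eC (∑ i, α i * (MvPolynomial.eval x (f i) : ℝ))

/-- The complete exponential sum `S_{a,q} = ∑_{x mod q} e(a · f(x)/q)`. -/
def Sgauss {n R : ℕ} (f : Fin R → MvPolynomial (Fin n) ℤ) (q : ℕ) (a : Fin R → ℤ) : ℂ :=
  ∑ x : Fin n → Fin q,
    eC ((∑ i, (a i : ℝ) * (MvPolynomial.eval (fun j => ((x j : ℕ) : ℤ)) (f i) : ℝ)) / q)

/-- `S_{a,q}(ν) = S_{a,q} e(-a·ν/q)`. -/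
def SgaussNu {n R : ℕ} (f : Fin R → MvPolynomial (Fin n) ℤ) (q : ℕ) (a : Fin R → ℤ)
    (ν : Fin R → ℤ) : ℂ :=
  Sgauss f q a * eC (-(∑ i, (a i : ℝ) * (ν i : ℝ)) / q)

/-- Residues `1 ≤ aᵢ ≤ q` (coded by `Fin q`, shifted by one) with `gcd(a₁, …, a_R, s) = 1`. -/
def resSet (R q s : ℕ) : Finset (Fin R → Fin q) :=
  Finset.univ.filter fun a => Nat.gcd (Finset.univ.gcd fun i => (a i : ℕ) + 1) s = 1

/-- The singular series `𝔖(ν)`. -/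
def singularSeries {n R : ℕ} (f : Fin R → MvPolynomial (Fin n) ℤ) (ν : Fin R → ℤ) : ℂ :=
  ∑' q : ℕ, ((q : ℂ) ^ n)⁻¹ *
    ∑ a ∈ resSet R q q, SgaussNu f q (fun i => ((a i : ℕ) : ℤ) + 1) ν

/-- The local density `𝔖_p(ν)`. -/
def localDensity {n R : ℕ} (f : Fin R → MvPolynomial (Fin n) ℤ) (ν : Fin R → ℤ) (p : ℕ) : ℂ :=
  ∑' r : ℕ, ((p : ℂ) ^ (r * n))⁻¹ *
    ∑ a ∈ resSet R (p ^ r) p, SgaussNu f (p ^ r) (fun i => ((a i : ℕ) : ℤ) + 1) ν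

/-- The box `𝓑 = ∏ⱼ [aⱼ, bⱼ]` as a subset of `ℝ^n`. -/
def boxSet {n : ℕ} (aB bB : Fin n → ℝ) : Set (Fin n → ℝ) :=
  Set.univ.pi fun j => Set.Icc (aB j) (bB j)

/-- The oscillatory integral `I(𝓒, γ) = ∫_{ζ ∈ 𝓒} e(γ · g(ζ)) dζ`. -/
def Iosc {n R : ℕ} (g : Fin R → MvPolynomial (Fin n) ℤ) (C : Set (Fin n → ℝ))
    (γ : Fin R → ℝ) : ℂ :=
  ∫ ζ in C, eC (∑ i, γ i * MvPolynomial.aeval ζ (g i))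

/-- `J(μ, Φ) = ∫_{|γ| ≤ Φ} I(𝓑, γ) e(-γ·μ) dγ`. -/
def Jint {n R : ℕ} (g : Fin R → MvPolynomial (Fin n) ℤ) (aB bB : Fin n → ℝ)
    (μ : Fin R → ℝ) (Φ : ℝ) : ℂ :=
  ∫ γ in {γ : Fin R → ℝ | ∀ i, |γ i| ≤ Φ}, Iosc g (boxSet aB bB) γ * eC (-(∑ i, γ i * μ i))

/-- The singular integral `J(μ) = lim_{Φ → ∞} J(μ, Φ)`. -/
def Jlim {n R : ℕ} (g : Fin R → MvPolynomial (Fin n) ℤ) (aB bB : Fin n → ℝ)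
    (μ : Fin R → ℝ) : ℂ :=
  limUnder Filter.atTop fun Φ : ℝ => Jint g aB bB μ Φ

/-- `M(P, ν)`: the number of integer points `x ∈ P𝓑` with `f(x) = ν`. -/
def Mcount {n R : ℕ} (f : Fin R → MvPolynomial (Fin n) ℤ) (aB bB : Fin n → ℝ) (P : ℝ)
    (ν : Fin R → ℤ) : ℕ :=
  ((boxPts aB bB P).filter fun x => ∀ i, MvPolynomial.eval x (f i) = ν i).card

/-- A single major arc `𝔐_{a,q}(θ)`. -/
def majorArc {R : ℕ} (d : ℕ) (Ct P θ : ℝ) (q : ℕ) (a : Fin R → ℤ) : Set (Fin R → ℝ) :=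
  Set.univ.pi fun i => Set.Icc
    ((a i : ℝ) / q - Ct ^ (R - 1) * P ^ (-(d : ℝ) + (R : ℝ) * ((d : ℝ) - 1) * θ) / (2 * q))
    ((a i : ℝ) / q + Ct ^ (R - 1) * P ^ (-(d : ℝ) + (R : ℝ) * ((d : ℝ) - 1) * θ) / (2 * q))

/-- The major arcs `𝔐(θ)`. -/
def majorArcs (R d : ℕ) (Ct P θ : ℝ) : Set (Fin R → ℝ) :=
  ⋃ (q : ℕ) (_ : 1 ≤ q ∧ (q : ℝ) ≤ Ct ^ R * P ^ ((R : ℝ) * ((d : ℝ) - 1) * θ))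
    (a : Fin R → ℤ)
    (_ : (∀ i, 1 ≤ a i ∧ a i ≤ (q : ℤ)) ∧ Int.gcd (Finset.univ.gcd a) (q : ℤ) = 1),
    majorArc d Ct P θ q a

/-- The minor arcs `𝔪 = [0,1]^R \ 𝔐(θ)`, taken modulo `1`. -/
def minorArcs (R d : ℕ) (Ct P θ : ℝ) : Set (Fin R → ℝ) :=
  {α | (∀ i, 0 ≤ α i ∧ α i ≤ 1) ∧
    ∀ z : Fin R → ℤ, (fun i => α i + (z i : ℝ)) ∉ majorArcs R d Ct P θ}

/-- Nonsingularity of the affine variety `f = 0` over `ℚ̄`: at every common zero the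
Jacobian matrix has (maximal) rank `R`, i.e. some `R × R` minor is nonvanishing. -/
def AffineNonsingular {n : ℕ} (R : ℕ) (f : Fin R → MvPolynomial (Fin n) ℤ) : Prop :=
  ∀ x : Fin n → Qbar, (∀ i, MvPolynomial.aeval x (f i) = 0) →
    ∃ (I : Finset (Fin n)) (hI : I.card = R), MvPolynomial.aeval x (jacMinor f I hI) ≠ 0

/-- Nonsingularity of the projective variety `g = 0` over `ℚ̄` (for forms `g`): at every
nonzero point of the affine cone the Jacobian matrix has rank `R`. -/
def ProjNonsingular {n : ℕ} (R : ℕ) (g : Fin R → MvPolynomial (Fin n) ℤ) : Prop :=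
  ∀ x : Fin n → Qbar, x ≠ 0 → (∀ i, MvPolynomial.aeval x (g i) = 0) →
    ∃ (I : Finset (Fin n)) (hI : I.card = R), MvPolynomial.aeval x (jacMinor g I hI) ≠ 0


/-! ### The additive character -/

lemma eC_norm (t : ℝ) : ‖eC t‖ = 1 := by
  unfold eC
  have : (2 * (Real.pi : ℂ) * Complex.I * (t : ℂ)) = ((2 * Real.pi * t : ℝ) : ℂ) * Complex.I := by
    push_cast; ring
  rw [this, Complex.norm_exp_ofReal_mul_I]

lemma eC_add (s t : ℝ) : eC (s + t) = eC s * eC t := by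
  unfold eC
  rw [← Complex.exp_add]
  congr 1
  push_cast; ring

lemma eC_int (k : ℤ) : eC (k : ℝ) = 1 := by
  unfold eC
  rw [Complex.exp_eq_one_iff]
  exact ⟨k, by push_cast; ring⟩

lemma eC_continuous : Continuous eC := by
  unfold eC
  fun_prop

lemma eC_lip (s t : ℝ) : ‖eC s - eC t‖ ≤ 2 * Real.pi * |s - t| := by
  have h : eC s = eC t * eC (s - t) := by rw [← eC_add]; congr 1; ring
  have h2 : eC s - eC t = eC t * (eC (s - t) - 1) := by rw [h]; ring
  rw [h2, norm_mul, eC_norm, one_mul]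
  have h3 : eC (s - t) = Complex.exp (Complex.I * ((2 * Real.pi * (s - t) : ℝ) : ℂ)) := by
    unfold eC; congr 1; push_cast; ring
  rw [h3]
  refine (Real.norm_exp_I_mul_ofReal_sub_one_le).trans ?_
  rw [Real.norm_eq_abs, abs_mul, abs_of_pos (by positivity : (0:ℝ) < 2 * Real.pi)]

/-! ### Polynomial estimates -/

lemma abs_prod_pow_le {n : ℕ} (s : Finset (Fin n)) (m : Fin n → ℕ) (x : Fin n → ℝ) (M : ℝ)
    (hx : ∀ j, |x j| ≤ M) : |∏ j ∈ s, x j ^ m j| ≤ M ^ (∑ j ∈ s, m j) := by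
  rw [Finset.abs_prod, ← Finset.prod_pow_eq_pow_sum]
  refine Finset.prod_le_prod (fun _ _ => abs_nonneg _) fun j _ => ?_
  rw [abs_pow]
  exact pow_le_pow_left₀ (abs_nonneg _) (hx j) _

lemma pow_lip (x y M D : ℝ) (hx : |x| ≤ M) (hy : |y| ≤ M) (hxy : |x - y| ≤ D) (k : ℕ) :
    M * |x ^ k - y ^ k| ≤ k * D * M ^ k := by
  have hM : 0 ≤ M := (abs_nonneg x).trans hx
  have hD : 0 ≤ D := (abs_nonneg _).trans hxy
  induction k with
  | zero => simp
  | succ k ih =>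
    have h1 : x ^ (k+1) - y ^ (k+1) = x * (x ^ k - y ^ k) + (x - y) * y ^ k := by ring
    have h2 : |x ^ (k+1) - y ^ (k+1)| ≤ M * |x ^ k - y ^ k| + D * M ^ k := by
      rw [h1]
      refine (abs_add_le _ _).trans ?_
      rw [abs_mul, abs_mul, abs_pow]
      gcongr
    calc M * |x ^ (k+1) - y ^ (k+1)| ≤ M * (M * |x ^ k - y ^ k| + D * M ^ k) := by gcongr
      _ ≤ M * (k * D * M ^ k + D * M ^ k) := by gcongr
      _ = _ := by push_cast; ring

lemma prod_lip {n : ℕ} (s : Finset (Fin n)) (m : Fin n → ℕ) (x y : Fin n → ℝ) (M D : ℝ)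
    (hM : 0 ≤ M) (hD : 0 ≤ D)
    (hx : ∀ j, |x j| ≤ M) (hy : ∀ j, |y j| ≤ M) (hxy : ∀ j, |x j - y j| ≤ D) :
    M * |∏ j ∈ s, x j ^ m j - ∏ j ∈ s, y j ^ m j| ≤
      ((∑ j ∈ s, m j : ℕ) : ℝ) * D * M ^ (∑ j ∈ s, m j) := by
  induction s using Finset.induction_on with
  | empty => simp
  | insert j s hj ih =>
    rw [Finset.prod_insert hj, Finset.prod_insert hj, Finset.sum_insert hj]
    set A := ∏ j ∈ s, x j ^ m j
    set B := ∏ j ∈ s, y j ^ m j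
    set S := ∑ j ∈ s, m j
    have hB : |B| ≤ M ^ S := abs_prod_pow_le s m y M hy
    have h1 : x j ^ m j * A - y j ^ m j * B = x j ^ m j * (A - B) + (x j ^ m j - y j ^ m j) * B := by
      ring
    have h2 := pow_lip _ _ M D (hx j) (hy j) (hxy j) (m j)
    have h3 : |x j ^ m j| ≤ M ^ m j := by
      rw [abs_pow]; exact pow_le_pow_left₀ (abs_nonneg _) (hx j) _
    calc M * |x j ^ m j * A - y j ^ m j * B|
        ≤ M * (|x j ^ m j| * |A - B| + |x j ^ m j - y j ^ m j| * |B|) := by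
          rw [h1]; gcongr
          refine (abs_add_le _ _).trans ?_
          rw [abs_mul, abs_mul]
      _ = |x j ^ m j| * (M * |A - B|) + (M * |x j ^ m j - y j ^ m j|) * |B| := by ring
      _ ≤ M ^ m j * (S * D * M ^ S) + (m j * D * M ^ m j) * M ^ S := by gcongr
      _ = _ := by push_cast; ring

/-- The exponents with all entries at most `d`. -/
def expBox (n d : ℕ) : Finset (Fin n →₀ ℕ) :=
  Finset.Iic (Finsupp.equivFunOnFinite.symm fun _ => d)

lemma mem_expBox {n d : ℕ} (m : Fin n →₀ ℕ) (h : m.degree ≤ d) : m ∈ expBox n d := by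
  rw [expBox, Finset.mem_Iic]
  intro j
  simp only [Finsupp.equivFunOnFinite_symm_apply_apply]
  exact (Finsupp.le_degree j m).trans h

lemma aeval_expand {n : ℕ} (x : Fin n → ℝ) (g : MvPolynomial (Fin n) ℤ) :
    MvPolynomial.aeval x g = ∑ m ∈ g.support, ((g.coeff m : ℤ) : ℝ) * ∏ j, x j ^ m j := by
  rw [MvPolynomial.aeval_def, MvPolynomial.eval₂_eq']
  simp

lemma lower_bound {n d : ℕ} (f : MvPolynomial (Fin n) ℤ) (hf : f.totalDegree = d) (C P : ℝ)
    (hC : ∀ m, |((f.coeff m : ℤ) : ℝ)| ≤ C) (hP : 1 ≤ P) (x : Fin n → ℝ) (hx : ∀ j, |x j| ≤ P) :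
    P * |MvPolynomial.aeval x f - MvPolynomial.aeval x (MvPolynomial.homogeneousComponent d f)|
      ≤ (expBox n d).card * C * P ^ d := by
  have hC0 : 0 ≤ C := (abs_nonneg _).trans (hC 0)
  rw [← map_sub]
  set g := f - MvPolynomial.homogeneousComponent d f with hg
  have hc : ∀ m, g.coeff m = if m.degree = d then 0 else f.coeff m := by
    intro m
    rw [hg, MvPolynomial.coeff_sub, MvPolynomial.coeff_homogeneousComponent]
    split_ifs <;> simp
  have hs : ∀ m ∈ g.support, m.degree < d ∧ |((g.coeff m : ℤ) : ℝ)| ≤ C := by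
    intro m hm
    rw [MvPolynomial.mem_support_iff, hc] at hm
    rw [hc]
    split_ifs at hm ⊢ with h
    · exact absurd rfl hm
    · refine ⟨lt_of_le_of_ne ?_ h, hC m⟩
      rw [← hf]
      exact MvPolynomial.le_totalDegree (MvPolynomial.mem_support_iff.2 hm)
  rw [aeval_expand]
  calc P * |∑ m ∈ g.support, ((g.coeff m : ℤ) : ℝ) * ∏ j, x j ^ m j|
      ≤ P * ∑ m ∈ g.support, |((g.coeff m : ℤ) : ℝ) * ∏ j, x j ^ m j| := by
        gcongr; exact Finset.abs_sum_le_sum_abs _ _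
    _ = ∑ m ∈ g.support, P * |((g.coeff m : ℤ) : ℝ) * ∏ j, x j ^ m j| := Finset.mul_sum _ _ _
    _ ≤ ∑ m ∈ g.support, C * P ^ d := by
        refine Finset.sum_le_sum fun m hm => ?_
        obtain ⟨h1, h2⟩ := hs m hm
        have h3 := abs_prod_pow_le Finset.univ m x P hx
        rw [← Finsupp.degree_eq_sum] at h3
        rw [abs_mul]
        calc P * (|((g.coeff m : ℤ) : ℝ)| * |∏ j, x j ^ m j|) ≤ P * (C * P ^ m.degree) := by gcongr
          _ = C * P ^ (m.degree + 1) := by ring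
          _ ≤ C * P ^ d := by gcongr; exact h1
    _ = g.support.card * (C * P ^ d) := by rw [Finset.sum_const, nsmul_eq_mul]
    _ ≤ (expBox n d).card * (C * P ^ d) := by
        gcongr
        exact fun m hm => mem_expBox m (hs m hm).1.le
    _ = _ := by ring

lemma hom_lip {n d : ℕ} (g : MvPolynomial (Fin n) ℤ) (hg : g.IsHomogeneous d) (C M D : ℝ)
    (hC : ∀ m, |((g.coeff m : ℤ) : ℝ)| ≤ C) (hM : 0 ≤ M) (hD : 0 ≤ D) (x y : Fin n → ℝ)
    (hx : ∀ j, |x j| ≤ M) (hy : ∀ j, |y j| ≤ M) (hxy : ∀ j, |x j - y j| ≤ D) :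
    M * |MvPolynomial.aeval x g - MvPolynomial.aeval y g|
      ≤ (expBox n d).card * C * (d * D * M ^ d) := by
  have hC0 : 0 ≤ C := (abs_nonneg _).trans (hC 0)
  have hs : ∀ m ∈ g.support, m.degree = d := by
    intro m hm
    rw [Finsupp.degree_eq_weight_one]
    exact hg (MvPolynomial.mem_support_iff.1 hm)
  rw [aeval_expand, aeval_expand, ← Finset.sum_sub_distrib]
  calc _ ≤ M * ∑ m ∈ g.support, |((g.coeff m : ℤ) : ℝ) * ∏ j, x j ^ m j -
            ((g.coeff m : ℤ) : ℝ) * ∏ j, y j ^ m j| := by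
        gcongr; exact Finset.abs_sum_le_sum_abs _ _
    _ = ∑ m ∈ g.support, M * |((g.coeff m : ℤ) : ℝ) * ∏ j, x j ^ m j -
            ((g.coeff m : ℤ) : ℝ) * ∏ j, y j ^ m j| := Finset.mul_sum _ _ _
    _ ≤ ∑ m ∈ g.support, C * (d * D * M ^ d) := by
        refine Finset.sum_le_sum fun m hm => ?_
        have h3 := prod_lip Finset.univ m x y M D hM hD hx hy hxy
        rw [← Finsupp.degree_eq_sum, hs m hm] at h3
        rw [← mul_sub, abs_mul]
        calc _ = |((g.coeff m : ℤ) : ℝ)| * (M * |∏ j, x j ^ m j - ∏ j, y j ^ m j|) := by ring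
          _ ≤ _ := by gcongr; exact hC m
    _ = g.support.card * (C * (d * D * M ^ d)) := by rw [Finset.sum_const, nsmul_eq_mul]
    _ ≤ (expBox n d).card * (C * (d * D * M ^ d)) := by
        gcongr
        exact fun m hm => mem_expBox m (hs m hm).le
    _ = _ := by ring

lemma hom_scale {n d : ℕ} (g : MvPolynomial (Fin n) ℤ) (hg : g.IsHomogeneous d) (P : ℝ)
    (x : Fin n → ℝ) : MvPolynomial.aeval (P • x) g = P ^ d * MvPolynomial.aeval x g := by
  rw [aeval_expand, aeval_expand, Finset.mul_sum]
  refine Finset.sum_congr rfl fun m hm => ?_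
  have : m.degree = d := by
    rw [Finsupp.degree_eq_weight_one]
    exact hg (MvPolynomial.mem_support_iff.1 hm)
  simp only [Pi.smul_apply, smul_eq_mul, mul_pow, Finset.prod_mul_distrib]
  rw [Finset.prod_pow_eq_pow_sum, ← Finsupp.degree_eq_sum, this]
  ring

lemma aeval_cont {n : ℕ} (g : MvPolynomial (Fin n) ℤ) :
    Continuous fun x : Fin n → ℝ => MvPolynomial.aeval x g := by
  simp_rw [aeval_expand]
  fun_prop

lemma aeval_int {n : ℕ} (x : Fin n → ℤ) (g : MvPolynomial (Fin n) ℤ) :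
    MvPolynomial.aeval (fun j => (x j : ℝ)) g = ((MvPolynomial.eval x g : ℤ) : ℝ) := by
  rw [aeval_expand, MvPolynomial.eval_eq']
  push_cast
  rfl

/-! ### Comparing sums over residue classes with integrals -/

lemma mem_boxPts {n : ℕ} (aB bB : Fin n → ℝ) (P : ℝ) (x : Fin n → ℤ) :
    x ∈ boxPts aB bB P ↔ ∀ j, P * aB j ≤ x j ∧ (x j : ℝ) ≤ P * bB j := by
  rw [boxPts, Finset.mem_Icc, Pi.le_def, Pi.le_def, ← forall_and]
  simp only [Int.ceil_le, Int.le_floor]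

/-- The half-open cube with corner `x` and side `q`. -/
def cube {n : ℕ} (q : ℕ) (x : Fin n → ℤ) : Set (Fin n → ℝ) :=
  Set.univ.pi fun j => Set.Ico (x j : ℝ) (x j + q)

lemma cube_vol {n : ℕ} (q : ℕ) (x : Fin n → ℤ) :
    (volume (cube q x)).toReal = (q : ℝ) ^ n := by
  rw [cube, Real.volume_pi_Ico_toReal]
  · simp
  · intro j; simp

lemma cube_meas {n : ℕ} (q : ℕ) (x : Fin n → ℤ) : MeasurableSet (cube q x) :=
  MeasurableSet.univ_pi fun _ => measurableSet_Ico

lemma cube_fin {n : ℕ} (q : ℕ) (x : Fin n → ℤ) : volume (cube q x) ≠ ⊤ := by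
  rw [cube, Real.volume_pi_Ico]
  exact ENNReal.prod_ne_top fun _ _ => ENNReal.ofReal_ne_top

/-- The slab `{u ∈ [-M,M]^n : c ≤ u_j ≤ c + w}`. -/
def slab {n : ℕ} (M : ℝ) (j : Fin n) (c w : ℝ) : Set (Fin n → ℝ) :=
  Set.Icc (Function.update (fun _ => -M) j c) (Function.update (fun _ => M) j (c + w))

lemma mem_slab {n : ℕ} {M : ℝ} {j : Fin n} {c w : ℝ} {u : Fin n → ℝ} (hu : ∀ k, |u k| ≤ M)
    (h1 : c ≤ u j) (h2 : u j ≤ c + w) : u ∈ slab M j c w := by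
  constructor
  · intro k
    by_cases h : k = j
    · subst h; simpa using h1
    · simpa [h] using (abs_le.1 (hu k)).1
  · intro k
    by_cases h : k = j
    · subst h; simpa using h2
    · simpa [h] using (abs_le.1 (hu k)).2

lemma slab_vol {n : ℕ} (M : ℝ) (hM : 0 ≤ M) (j : Fin n) (c w : ℝ) (hw : 0 ≤ w) :
    volume.real (slab M j c w) = w * (2 * M) ^ (n - 1) := by
  rw [Measure.real, slab, Real.volume_Icc_pi_toReal]
  · have : ∀ k, Function.update (fun _ => M) j (c + w) k - Function.update (fun _ => -M) j c k =
        Function.update (fun _ => 2 * M) j w k := by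
      intro k
      by_cases h : k = j
      · subst h; simp
      · simp [h]; ring
    simp_rw [this]
    rw [Finset.prod_update_of_mem (Finset.mem_univ _), Finset.prod_const,
      Finset.card_sdiff_of_subset (by simp)]
    simp
  · intro k
    by_cases h : k = j
    · subst h; simpa using hw
    · simp [h]; linarith

lemma int_ind (n : ℕ) (l u : Fin n → ℝ) (L : ℝ) :
    Integrable ((Set.Icc l u).indicator fun _ => L) := by
  refine (integrable_indicator_iff measurableSet_Icc).2 ?_
  exact integrableOn_const (isCompact_Icc.measure_lt_top.ne)

lemma riemann {n : ℕ} (G : (Fin n → ℝ) → ℂ) (hGc : Continuous G) (hG1 : ∀ u, ‖G u‖ ≤ 1)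
    (P L : ℝ) (q : ℕ) (hq : 1 ≤ q) (hqP : (q : ℝ) ≤ P) (hL : 0 ≤ L)
    (hGL : ∀ u v : Fin n → ℝ, (∀ j, |u j| ≤ 2 * P) → (∀ j, |v j| ≤ 2 * P) →
      (∀ j, |u j - v j| ≤ q) → ‖G u - G v‖ ≤ L)
    (aB bB : Fin n → ℝ) (hB : ∀ j, -1 ≤ aB j ∧ aB j ≤ bB j ∧ bB j ≤ 1)
    (z : Fin n → ℤ) :
    ‖(q : ℂ) ^ n * ∑ x ∈ boxPts aB bB P with (∀ j, (q : ℤ) ∣ x j - z j), G (fun j => x j) -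
      ∫ u in boxSet (fun j => P * aB j) (fun j => P * bB j), G u‖ ≤
      L * (4 * P) ^ n + 2 * n * (q * (4 * P) ^ (n - 1)) := by
  classical
  have hq0 : (1:ℝ) ≤ q := by exact_mod_cast hq
  have hP0 : 0 ≤ P := by linarith
  set X := (boxPts aB bB P).filter (fun x => ∀ j, (q : ℤ) ∣ x j - z j) with hX
  set S := boxSet (fun j => P * aB j) (fun j => P * bB j) with hS
  have hSm : MeasurableSet S := MeasurableSet.univ_pi fun _ => measurableSet_Icc
  have hSc : IsCompact S := isCompact_univ_pi fun _ => isCompact_Icc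
  have i1 : ∀ x ∈ X, Integrable ((cube q x).indicator fun _ => G (fun j => (x j : ℝ))) := by
    intro x _
    exact (integrable_indicator_iff (cube_meas q x)).2 (integrableOn_const (cube_fin q x))
  have i2 : Integrable (S.indicator G) :=
    (integrable_indicator_iff hSm).2 (hGc.continuousOn.integrableOn_compact hSc)
  have e1 : (q : ℂ) ^ n * ∑ x ∈ X, G (fun j => x j) - ∫ u in S, G u =
      ∫ u, (∑ x ∈ X, (cube q x).indicator (fun _ => G (fun j => (x j : ℝ))) u - S.indicator G u) := by
    rw [integral_sub (integrable_finsetSum _ i1) i2, integral_finsetSum _ i1,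
      integral_indicator hSm, Finset.mul_sum]
    congr 1
    refine Finset.sum_congr rfl fun x _ => ?_
    rw [integral_indicator (cube_meas q x), setIntegral_const, Measure.real, cube_vol,
      Complex.real_smul]
    push_cast; rfl
  rw [e1]
  set W : Set (Fin n → ℝ) := Set.Icc (fun _ => -(2*P)) (fun _ => 2 * P) with hW
  let bd : (Fin n → ℝ) → ℝ := fun u => W.indicator (fun _ => L) u +
    ∑ j, ((slab (2*P) j (P * aB j) q).indicator (fun _ => (1:ℝ)) u +
      (slab (2*P) j (P * bB j) q).indicator (fun _ => (1:ℝ)) u)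
  have ib2 : ∀ j ∈ Finset.univ, Integrable (fun u => (slab (2*P) j (P * aB j) q).indicator (fun _ => (1:ℝ)) u +
      (slab (2*P) j (P * bB j) q).indicator (fun _ => (1:ℝ)) u) := fun j _ =>
    (int_ind n _ _ 1).add (int_ind n _ _ 1)
  have ib : Integrable bd := (int_ind n _ _ L).add (integrable_finsetSum _ ib2)
  have hb : ∫ u, bd u = L * (4 * P) ^ n + 2 * n * (q * (4 * P) ^ (n - 1)) := by
    rw [integral_add (int_ind n _ _ L) (integrable_finsetSum _ ib2), integral_finsetSum _ ib2]
    have : ∀ j : Fin n, ∫ u, ((slab (2*P) j (P * aB j) q).indicator (fun _ => (1:ℝ)) u +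
      (slab (2*P) j (P * bB j) q).indicator (fun _ => (1:ℝ)) u) = 2 * (q * (4 * P) ^ (n - 1)) := by
      intro j
      refine (integral_add (int_ind n _ _ 1) (int_ind n _ _ 1)).trans ?_
      change (∫ u, (slab (2*P) j (P * aB j) q).indicator (fun _ => (1:ℝ)) u) +
        ∫ u, (slab (2*P) j (P * bB j) q).indicator (fun _ => (1:ℝ)) u = _
      have ms : ∀ c : ℝ, MeasurableSet (slab (2*P) j c (q:ℝ)) := fun c => measurableSet_Icc
      rw [integral_indicator (ms _), integral_indicator (ms _),
        setIntegral_const, setIntegral_const, slab_vol _ (by linarith) _ _ _ (by linarith),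
        slab_vol _ (by linarith) _ _ _ (by linarith)]
      rw [smul_eq_mul]; ring
    rw [Finset.sum_congr rfl fun j _ => this j, Finset.sum_const, nsmul_eq_mul,
      integral_indicator measurableSet_Icc, setIntegral_const, Measure.real,
      Real.volume_Icc_pi_toReal (fun j => by simp; linarith)]
    simp only [Finset.prod_const, Finset.card_univ, Fintype.card_fin, smul_eq_mul]
    ring
  rw [← hb]
  refine norm_integral_le_of_norm_le ib (ae_of_all _ fun u => ?_)
  -- pointwise bound
  have nn : ∀ j, 0 ≤ (slab (2*P) j (P * aB j) q).indicator (fun _ => (1:ℝ)) u +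
      (slab (2*P) j (P * bB j) q).indicator (fun _ => (1:ℝ)) u := fun j =>
    add_nonneg (Set.indicator_nonneg (fun _ _ => zero_le_one) _)
      (Set.indicator_nonneg (fun _ _ => zero_le_one) _)
  have nW : 0 ≤ W.indicator (fun _ => L) u := Set.indicator_nonneg (fun _ _ => hL) _
  have bdnn : 0 ≤ bd u := add_nonneg nW (Finset.sum_nonneg fun j _ => nn j)
  have ba : ∀ j, u ∈ slab (2*P) j (P * aB j) q → 1 ≤ bd u := by
    intro j hj
    have h1 := Finset.single_le_sum (fun j _ => nn j) (Finset.mem_univ j)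
    have h2 : 0 ≤ (slab (2*P) j (P * bB j) q).indicator (fun _ => (1:ℝ)) u :=
      Set.indicator_nonneg (fun _ _ => zero_le_one) _
    rw [Set.indicator_of_mem hj] at h1
    simp only [bd]
    linarith
  have bb : ∀ j, u ∈ slab (2*P) j (P * bB j) q → 1 ≤ bd u := by
    intro j hj
    have h1 := Finset.single_le_sum (fun j _ => nn j) (Finset.mem_univ j)
    have h2 : 0 ≤ (slab (2*P) j (P * aB j) q).indicator (fun _ => (1:ℝ)) u :=
      Set.indicator_nonneg (fun _ _ => zero_le_one) _
    rw [Set.indicator_of_mem hj] at h1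
    simp only [bd]
    linarith
  have hbox : ∀ j, ∀ t : ℝ, P * aB j ≤ t → t ≤ P * bB j → -P ≤ t ∧ t ≤ P := by
    intro j t h1 h2
    obtain ⟨h3, _, h4⟩ := hB j
    constructor <;> nlinarith
  have memS : u ∈ S ↔ ∀ j, P * aB j ≤ u j ∧ u j ≤ P * bB j := by
    simp only [hS, boxSet, Set.mem_pi, Set.mem_univ, true_implies, Set.mem_Icc]
  by_cases hex : ∃ x ∈ X, u ∈ cube q x
  · obtain ⟨x, hxX, hux⟩ := hex
    have hx := Finset.mem_filter.1 hxX
    have hxb := (mem_boxPts aB bB P x).1 hx.1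
    have hux' : ∀ j, (x j : ℝ) ≤ u j ∧ u j < x j + q := by
      simpa [cube, Set.mem_pi] using hux
    have hsum : ∑ x ∈ X, (cube q x).indicator (fun _ => G (fun j => (x j : ℝ))) u =
        G (fun j => x j) := by
      rw [Finset.sum_eq_single_of_mem x hxX, Set.indicator_of_mem hux]
      intro y hyX hyx
      apply Set.indicator_of_notMem
      intro huy
      have huy' : ∀ j, (y j : ℝ) ≤ u j ∧ u j < y j + q := by
        simpa [cube, Set.mem_pi] using huy
      have hy := Finset.mem_filter.1 hyX
      apply hyx
      funext j
      have hdv : (q : ℤ) ∣ y j - x j := by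
        have := dvd_sub (hy.2 j) (hx.2 j)
        simpa using this
      have l1 : y j < x j + q := by
        have : (y j : ℝ) < x j + q := by linarith [(huy' j).1, (hux' j).2]
        exact_mod_cast this
      have l2 : x j < y j + q := by
        have : (x j : ℝ) < y j + q := by linarith [(huy' j).2, (hux' j).1]
        exact_mod_cast this
      have := Int.eq_zero_of_abs_lt_dvd hdv (abs_lt.2 ⟨by linarith, by linarith⟩)
      linarith
    rw [hsum]
    have hu2 : ∀ j, |u j| ≤ 2 * P := by
      intro j
      have := hbox j _ (hxb j).1 (hxb j).2
      have := hux' j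
      rw [abs_le]; constructor <;> linarith
    have hx2 : ∀ j, |(x j : ℝ)| ≤ 2 * P := by
      intro j
      have := hbox j _ (hxb j).1 (hxb j).2
      rw [abs_le]; constructor <;> linarith
    by_cases huS : u ∈ S
    · rw [Set.indicator_of_mem huS]
      refine (hGL _ u hx2 hu2 fun j => ?_).trans ?_
      · have := hux' j
        rw [abs_le]; constructor <;> linarith
      · have : u ∈ W := ⟨fun j => (abs_le.1 (hu2 j)).1, fun j => (abs_le.1 (hu2 j)).2⟩
        simp only [bd]
        rw [Set.indicator_of_mem this]
        have := Finset.sum_nonneg fun j (_ : j ∈ Finset.univ) => nn j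
        linarith
    · rw [Set.indicator_of_notMem huS, sub_zero]
      rw [memS] at huS
      push Not at huS
      obtain ⟨j, hj⟩ := huS
      have h1 := hj (by linarith [(hxb j).1, (hux' j).1])
      refine (hG1 _).trans (bb j (mem_slab hu2 h1.le ?_))
      linarith [(hxb j).2, (hux' j).2]
  · push Not at hex
    rw [Finset.sum_eq_zero fun x hx => Set.indicator_of_notMem (hex x hx) _, zero_sub, norm_neg]
    by_cases huS : u ∈ S
    · rw [Set.indicator_of_mem huS]
      have huS' := memS.1 huS
      let x : Fin n → ℤ := fun j => z j + q * ⌊(u j - z j) / q⌋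
      have hux : ∀ j, (x j : ℝ) ≤ u j ∧ u j < x j + q := by
        intro j
        have f1 := Int.floor_le ((u j - z j) / q)
        have f2 := Int.lt_floor_add_one ((u j - z j) / q)
        have hqp : (0:ℝ) < q := by linarith
        rw [le_div_iff₀ hqp] at f1
        rw [div_lt_iff₀ hqp] at f2
        simp only [x]
        push_cast
        constructor <;> nlinarith
      have hxX : x ∉ X := by
        intro h
        refine hex x h ?_
        simpa [cube, Set.mem_pi] using hux
      have : x ∉ boxPts aB bB P := by
        intro h
        exact hxX (Finset.mem_filter.2 ⟨h, fun j => by simp [x]⟩)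
      rw [mem_boxPts] at this
      push Not at this
      obtain ⟨j, hj⟩ := this
      have h1 : (x j : ℝ) < P * aB j := by
        by_contra h
        have := hj (not_lt.1 h)
        linarith [(hux j).1, (huS' j).2]
      refine (hG1 _).trans (ba j (mem_slab (fun k => ?_) (huS' j).1 ?_))
      · have := hbox k _ (huS' k).1 (huS' k).2
        rw [abs_le]; constructor <;> linarith
      · linarith [(hux j).2]
    · rw [Set.indicator_of_notMem huS, norm_zero]
      exact bdnn

open scoped Pointwise in
lemma scale_int {n : ℕ} (G : (Fin n → ℝ) → ℂ) (P : ℝ) (hP : 0 < P) (aB bB : Fin n → ℝ) :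
    (P : ℂ) ^ n * ∫ u in boxSet aB bB, G (P • u) =
      ∫ u in boxSet (fun j => P * aB j) (fun j => P * bB j), G u := by
  have hs : P • boxSet aB bB = boxSet (fun j => P * aB j) (fun j => P * bB j) := by
    ext u
    rw [Set.mem_smul_set_iff_inv_smul_mem₀ hP.ne']
    simp only [boxSet, Set.mem_pi, Set.mem_univ, true_implies, Set.mem_Icc, Pi.smul_apply,
      smul_eq_mul]
    refine forall_congr' fun j => and_congr ?_ ?_
    · rw [le_inv_mul_iff₀ hP]
    · rw [inv_mul_le_iff₀ hP]
  rw [Measure.setIntegral_comp_smul volume G _ hP.ne', hs]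
  have : (0:ℝ) < P ^ n := by positivity
  rw [Module.finrank_fin_fun, abs_of_pos (by positivity), Complex.real_smul]
  push_cast
  rw [← mul_assoc, mul_inv_cancel₀, one_mul]
  exact_mod_cast this.ne'

/-! ### The main estimate -/

lemma card_boxPts_le {n : ℕ} (aB bB : Fin n → ℝ) (P : ℝ) (hP : 1 ≤ P)
    (hB : ∀ j, -1 ≤ aB j ∧ aB j ≤ bB j ∧ bB j ≤ 1) :
    ((boxPts aB bB P).card : ℝ) ≤ (3 * P) ^ n := by
  rw [boxPts, Pi.card_Icc]
  push_cast
  calc _ ≤ ∏ _j : Fin n, (3 * P) := by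
        refine Finset.prod_le_prod (fun _ _ => by positivity) fun j _ => ?_
        rw [Int.card_Icc]
        obtain ⟨h1, h2, h3⟩ := hB j
        have f1 := Int.floor_le (P * bB j)
        have f2 := Int.le_ceil (P * aB j)
        rcases le_total 0 (⌊P * bB j⌋ + 1 - ⌈P * aB j⌉) with h | h
        · have : (((⌊P * bB j⌋ + 1 - ⌈P * aB j⌉).toNat : ℤ) : ℝ) =
            ((⌊P * bB j⌋ + 1 - ⌈P * aB j⌉ : ℤ) : ℝ) := by rw [Int.toNat_of_nonneg h]
          rw [Int.cast_natCast] at this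
          rw [this]
          push_cast
          nlinarith
        · rw [Int.toNat_of_nonpos h]
          push_cast
          linarith
    _ = _ := by simp

lemma eval_congr {n : ℕ} (f : MvPolynomial (Fin n) ℤ) (q : ℕ) (x z : Fin n → ℤ)
    (h : ∀ j, (q : ℤ) ∣ x j - z j) :
    (q : ℤ) ∣ MvPolynomial.eval x f - MvPolynomial.eval z f := by
  rw [← ZMod.intCast_eq_intCast_iff_dvd_sub]
  rw [MvPolynomial.eval_eq', MvPolynomial.eval_eq']
  have : ∀ j, ((z j : ℤ) : ZMod q) = (x j : ℤ) := fun j =>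
    (ZMod.intCast_eq_intCast_iff_dvd_sub _ _ _).2 (h j)
  push_cast
  simp_rw [this]

lemma w_congr {n R : ℕ} (f : Fin R → MvPolynomial (Fin n) ℤ) (q : ℕ) (hq : 1 ≤ q)
    (a : Fin R → ℤ) (x z : Fin n → ℤ) (h : ∀ j, (q : ℤ) ∣ x j - z j) :
    eC ((∑ i, (a i : ℝ) * (MvPolynomial.eval x (f i) : ℝ)) / q) =
    eC ((∑ i, (a i : ℝ) * (MvPolynomial.eval z (f i) : ℝ)) / q) := by
  have hd : (q : ℤ) ∣ ∑ i, a i * (MvPolynomial.eval x (f i) - MvPolynomial.eval z (f i)) :=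
    Finset.dvd_sum fun i _ => (eval_congr (f i) q x z h).mul_left _
  obtain ⟨k, hk⟩ := hd
  have hk' : ∑ i, (a i : ℝ) * ((MvPolynomial.eval x (f i) : ℝ) - (MvPolynomial.eval z (f i) : ℝ))
      = q * k := by exact_mod_cast hk
  have hq0 : (q : ℝ) ≠ 0 := by positivity
  have : (∑ i, (a i : ℝ) * (MvPolynomial.eval x (f i) : ℝ)) / q =
      (∑ i, (a i : ℝ) * (MvPolynomial.eval z (f i) : ℝ)) / q + (k : ℝ) := by
    simp_rw [mul_sub, Finset.sum_sub_distrib] at hk'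
    field_simp
    linarith
  rw [this, eC_add, eC_int, mul_one]

lemma sum_fibers {n : ℕ} (q : ℕ) (hq : 1 ≤ q) (X : Finset (Fin n → ℤ)) (Φ : (Fin n → ℤ) → ℂ) :
    ∑ x ∈ X, Φ x = ∑ z : Fin n → Fin q,
      ∑ x ∈ X with (∀ j, (q : ℤ) ∣ x j - ((z j : ℕ) : ℤ)), Φ x := by
  have hq0 : (0 : ℤ) < q := by exact_mod_cast hq
  let r : (Fin n → ℤ) → (Fin n → Fin q) := fun x j =>
    ⟨(x j % q).toNat, by
      have h1 := Int.emod_nonneg (x j) hq0.ne'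
      have h2 := Int.emod_lt_of_pos (x j) hq0
      omega⟩
  rw [← Finset.sum_fiberwise X r Φ]
  refine Finset.sum_congr rfl fun z _ => ?_
  refine Finset.sum_congr (Finset.filter_congr fun x _ => ?_) fun _ _ => rfl
  rw [funext_iff]
  refine forall_congr' fun j => ?_
  have h1 := Int.emod_nonneg (x j) hq0.ne'
  have h3 := (z j).isLt
  rw [Fin.ext_iff]
  simp only [r]
  constructor
  · intro h
    rw [← h, Int.toNat_of_nonneg h1]
    exact Int.dvd_self_sub_emod
  · rintro ⟨k, hk⟩
    have hx : x j = ((z j : ℕ) : ℤ) + q * k := by linarith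
    rw [hx, Int.add_mul_emod_self_left, Int.emod_eq_of_lt (by positivity) (by exact_mod_cast h3)]
    simp

lemma main_est (n R d : ℕ) (hn : 1 ≤ n)
    (f : Fin R → MvPolynomial (Fin n) ℤ) (hf : ∀ i, (f i).totalDegree = d)
    (aB bB : Fin n → ℝ) (hB : ∀ j, -1 ≤ aB j ∧ aB j ≤ bB j ∧ bB j ≤ 1)
    (C Ct A P : ℝ) (hCt : 0 ≤ Ct) (hCC : Ct ≤ C) (hA : 0 ≤ A) (hP : 1 ≤ P)
    (hC : ∀ i m, |(((f i).coeff m : ℤ) : ℝ)| ≤ C)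
    (hCt' : ∀ i m, |(((MvPolynomial.homogeneousComponent d (f i)).coeff m : ℤ) : ℝ)| ≤ Ct)
    (q : ℕ) (hq : 1 ≤ q) (hqP : (q : ℝ) ≤ P) (hqA : (q : ℝ) ≤ Ct * A)
    (a : Fin R → ℤ) (β : Fin R → ℝ) (hβ : ∀ i, |β i| ≤ A / (2 * q * P ^ d)) :
    ‖Sexp f aB bB P (fun i => (a i : ℝ) / q + β i) -
      (P : ℂ) ^ n * ((q : ℂ) ^ n)⁻¹ * Sgauss f q a *
        Iosc (fun i => MvPolynomial.homogeneousComponent d (f i)) (boxSet aB bB)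
          (fun i => P ^ d * β i)‖ ≤
      (3 ^ n * Real.pi * R * (expBox n d).card +
        4 ^ n * (Real.pi * R * (expBox n d).card * d * 2 ^ d) + 2 * n * 4 ^ n) *
        (C * A * (P ^ n / P)) := by
  set N : ℝ := ((expBox n d).card : ℝ) with hN
  set g := fun i => MvPolynomial.homogeneousComponent d (f i) with hg
  have hgh : ∀ i, (g i).IsHomogeneous d := fun i =>
    MvPolynomial.homogeneousComponent_isHomogeneous d (f i)
  have hq0 : (1:ℝ) ≤ q := by exact_mod_cast hq
  have hP0 : 0 < P := by linarith
  have hC0 : 0 ≤ C := hCt.trans hCC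
  have hN0 : 0 ≤ N := by positivity
  set b : ℝ := A / (2 * q * P ^ d) with hb
  have hb0 : 0 ≤ b := by positivity
  set G : (Fin n → ℝ) → ℂ := fun u => eC (∑ i, β i * MvPolynomial.aeval u (g i)) with hG
  set w : (Fin n → ℤ) → ℂ := fun x =>
    eC ((∑ i, (a i : ℝ) * (MvPolynomial.eval x (f i) : ℝ)) / q) with hw
  have hGc : Continuous G := by
    refine eC_continuous.comp ?_
    exact continuous_finsetSum _ fun i _ => continuous_const.mul (aeval_cont (g i))
  have hG1 : ∀ u, ‖G u‖ ≤ 1 := fun u => (eC_norm _).le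
  have hphase : ∀ (s t : Fin R → ℝ) (D : ℝ), (∀ i, |s i - t i| ≤ D) →
      ‖eC (∑ i, β i * s i) - eC (∑ i, β i * t i)‖ ≤ 2 * Real.pi * (R * (b * D)) := by
    intro s t D hD
    refine (eC_lip _ _).trans ?_
    gcongr
    rw [← Finset.sum_sub_distrib]
    refine (Finset.abs_sum_le_sum_abs _ _).trans ?_
    calc _ ≤ ∑ _i : Fin R, b * D := by
          refine Finset.sum_le_sum fun i _ => ?_
          rw [← mul_sub, abs_mul]
          exact mul_le_mul (hβ i) (hD i) (abs_nonneg _) hb0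
      _ = _ := by simp
  -- Step 1 : replace `f` by its top form
  set T : ℂ := ∑ x ∈ boxPts aB bB P, w x * G (fun j => x j) with hT
  have step1 : ‖Sexp f aB bB P (fun i => (a i : ℝ) / q + β i) - T‖ ≤
      (3 * P) ^ n * (Real.pi * R * N * (C * A / P)) := by
    rw [Sexp, hT, ← Finset.sum_sub_distrib]
    refine (norm_sum_le _ _).trans ?_
    calc _ ≤ ∑ _x ∈ boxPts aB bB P, (Real.pi * R * N * (C * A / P)) := by
          refine Finset.sum_le_sum fun x hx => ?_
          have hxb := (mem_boxPts aB bB P x).1 hx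
          have hxP : ∀ j, |(x j : ℝ)| ≤ P := by
            intro j
            obtain ⟨h1, h2, h3⟩ := hB j
            have := hxb j
            rw [abs_le]; constructor <;> nlinarith
          have e : eC (∑ i, ((a i : ℝ) / q + β i) * (MvPolynomial.eval x (f i) : ℝ)) =
              w x * eC (∑ i, β i * MvPolynomial.aeval (fun j => (x j : ℝ)) (f i)) := by
            rw [hw, ← eC_add]
            congr 1
            rw [Finset.sum_div, ← Finset.sum_add_distrib]
            refine Finset.sum_congr rfl fun i _ => ?_
            rw [aeval_int]; ring
          rw [e, ← mul_sub, norm_mul, hw, eC_norm, one_mul]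
          refine (hphase _ _ (N * C * P ^ d / P) fun i => ?_).trans ?_
          · rw [le_div_iff₀ hP0, mul_comm]
            exact lower_bound (f i) (hf i) C P (hC i) hP _ hxP
          · have : 2 * Real.pi * (R * (b * (N * C * P ^ d / P))) =
                Real.pi * R * N * (C * A / P) / q := by
              rw [hb]; field_simp
            rw [this]
            exact div_le_self (by positivity) hq0
      _ = (boxPts aB bB P).card * (Real.pi * R * N * (C * A / P)) := by
          rw [Finset.sum_const, nsmul_eq_mul]
      _ ≤ _ := by
          gcongr
          exact card_boxPts_le aB bB P hP hB
  -- Step 2 : compare with the integral on each residue class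
  set J : ℂ := ∫ u in boxSet (fun j => P * aB j) (fun j => P * bB j), G u with hJ
  set L : ℝ := Real.pi * R * N * d * 2 ^ d * (Ct * A / P) with hL
  have hL0 : 0 ≤ L := by positivity
  set E : ℝ := L * (4 * P) ^ n + 2 * n * (q * (4 * P) ^ (n - 1)) with hE
  have hGL : ∀ u v : Fin n → ℝ, (∀ j, |u j| ≤ 2 * P) → (∀ j, |v j| ≤ 2 * P) →
      (∀ j, |u j - v j| ≤ q) → ‖G u - G v‖ ≤ L := by
    intro u v hu hv huv
    refine (hphase _ _ (N * Ct * (d * q * (2 * P) ^ d) / (2 * P)) fun i => ?_).trans ?_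
    · rw [le_div_iff₀ (by positivity), mul_comm]
      exact hom_lip (g i) (hgh i) Ct (2 * P) q (hCt' i) (by positivity) (by positivity) u v hu hv huv
    · have : 2 * Real.pi * (R * (b * (N * Ct * (d * q * (2 * P) ^ d) / (2 * P)))) = L / 2 := by
        rw [hb, hL]
        rw [mul_pow]
        field_simp
      rw [this]; linarith
  have step2 : ‖(q : ℂ) ^ n * T - Sgauss f q a * J‖ ≤ (q : ℝ) ^ n * E := by
    have e : (q : ℂ) ^ n * T - Sgauss f q a * J = ∑ z : Fin n → Fin q,
        w (fun j => ((z j : ℕ) : ℤ)) * ((q : ℂ) ^ n *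
          ∑ x ∈ boxPts aB bB P with (∀ j, (q : ℤ) ∣ x j - ((z j : ℕ) : ℤ)), G (fun j => x j) - J) := by
      rw [hT, sum_fibers q hq, Sgauss, Finset.mul_sum, Finset.sum_mul, ← Finset.sum_sub_distrib]
      refine Finset.sum_congr rfl fun z _ => ?_
      have : ∀ x ∈ (boxPts aB bB P).filter (fun x => ∀ j, (q : ℤ) ∣ x j - ((z j : ℕ) : ℤ)),
          w x * G (fun j => x j) = w (fun j => ((z j : ℕ) : ℤ)) * G (fun j => x j) := by
        intro x hx
        rw [hw]
        simp only
        rw [w_congr f q hq a x _ (Finset.mem_filter.1 hx).2]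
      rw [Finset.sum_congr rfl this, ← Finset.mul_sum]
      simp only [hw]
      ring
    rw [e]
    refine (norm_sum_le _ _).trans ?_
    calc _ ≤ ∑ _z : Fin n → Fin q, E := by
          refine Finset.sum_le_sum fun z _ => ?_
          rw [norm_mul, hw, eC_norm, one_mul]
          exact riemann G hGc hG1 P L q hq hqP hL0 hGL aB bB hB _
      _ = _ := by simp
  have hIosc : (P : ℂ) ^ n * Iosc g (boxSet aB bB) (fun i => P ^ d * β i) = J := by
    rw [hJ, ← scale_int G P hP0, Iosc]
    congr 2
    funext u
    rw [hG]
    simp only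
    congr 1
    refine Finset.sum_congr rfl fun i _ => ?_
    rw [hom_scale (g i) (hgh i)]; ring
  have hqn : (q : ℂ) ^ n ≠ 0 := by
    have : (q : ℂ) ≠ 0 := by exact_mod_cast (by omega : q ≠ 0)
    exact pow_ne_zero _ this
  have hqnr : (0:ℝ) < (q : ℝ) ^ n := by positivity
  have step3 : ‖T - (P : ℂ) ^ n * ((q : ℂ) ^ n)⁻¹ * Sgauss f q a *
        Iosc g (boxSet aB bB) (fun i => P ^ d * β i)‖ ≤ E := by
    have : T - (P : ℂ) ^ n * ((q : ℂ) ^ n)⁻¹ * Sgauss f q a *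
        Iosc g (boxSet aB bB) (fun i => P ^ d * β i) =
        ((q : ℂ) ^ n)⁻¹ * ((q : ℂ) ^ n * T - Sgauss f q a * J) := by
      rw [← hIosc]
      field_simp
    rw [this, norm_mul, norm_inv, norm_pow, Complex.norm_natCast, inv_mul_le_iff₀ hqnr]
    exact step2
  refine (norm_sub_le_norm_sub_add_norm_sub _ T _).trans ((add_le_add step1 step3).trans ?_)
  have hPn : P ^ n = P ^ (n - 1) * P := by
    rw [← pow_succ]; congr 1; omega
  have p1 : (3 * P) ^ n * (Real.pi * R * N * (C * A / P)) =
      (3 ^ n * Real.pi * R * N) * (C * A * (P ^ n / P)) := by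
    rw [mul_pow]; field_simp
  have p2 : L * (4 * P) ^ n ≤ 4 ^ n * (Real.pi * R * N * d * 2 ^ d) * (C * A * (P ^ n / P)) := by
    have : L * (4 * P) ^ n = 4 ^ n * (Real.pi * R * N * d * 2 ^ d) * (Ct * A * (P ^ n / P)) := by
      rw [hL, mul_pow]; field_simp
    rw [this]
    gcongr
  have p3 : 2 * n * (q * (4 * P) ^ (n - 1)) ≤ 2 * n * 4 ^ n * (C * A * (P ^ n / P)) := by
    have e : P ^ n / P = P ^ (n - 1) := by rw [hPn]; field_simp
    rw [e, mul_pow]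
    have h4 : (4:ℝ) ^ (n - 1) ≤ 4 ^ n := pow_le_pow_right₀ (by norm_num) (by omega)
    have hqC : (q : ℝ) ≤ C * A := hqA.trans (by gcongr)
    calc _ ≤ 2 * n * (C * A * (4 ^ n * P ^ (n - 1))) := by gcongr
      _ = _ := by ring
  rw [p1, hE]
  linarith

/-- **Corollary 2.9 (major arc approximation of `S(α,ν)`).** -/
theorem major_arc_approximation (n R d : ℕ) (hR : 0 < R) (hd : 2 ≤ d) (hnR : R < n) :
    ∃ c : ℝ, 0 < c ∧
      ∀ (f : Fin R → MvPolynomial (Fin n) ℤ),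
        (∀ i, (f i).totalDegree = d) →
        ∀ (aB bB : Fin n → ℝ),
        (∀ j, -1 ≤ aB j ∧ 0 < bB j - aB j ∧ bB j - aB j < 1 ∧ bB j ≤ 1) →
        ∀ C Ct K : ℝ, 1 ≤ C → 1 ≤ Ct →
        coeffMax f C →
        coeffMax (fun i => MvPolynomial.homogeneousComponent d (f i)) Ct →
        KofDelta n R d (fun i => MvPolynomial.homogeneousComponent d (f i)) K →
        ∀ θ₀ δ : ℝ, 0 < θ₀ → 0 < δ →
        ∀ P : ℝ, 2 ≤ P →
        (R : ℝ) * ((d : ℝ) - 1) * θ₀ + (R : ℝ) * Real.log Ct / Real.log P < 1 →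
        δ / ((R : ℝ) * ((d : ℝ) - 1) * θ₀) < K / ((R : ℝ) * ((d : ℝ) - 1)) - ((R : ℝ) + 1) →
        ∀ (ν : Fin R → ℤ) (q : ℕ) (a : Fin R → ℤ) (β : Fin R → ℝ),
          1 ≤ q → (q : ℝ) ≤ Ct ^ R * P ^ ((R : ℝ) * ((d : ℝ) - 1) * θ₀) →
          (∀ i, 1 ≤ a i ∧ a i ≤ (q : ℤ)) →
          Int.gcd (Finset.univ.gcd a) (q : ℤ) = 1 →
          (∀ i, |β i| ≤ Ct ^ (R - 1) * P ^ (-(d : ℝ) + (R : ℝ) * ((d : ℝ) - 1) * θ₀) / (2 * q)) →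
          ‖Sexp f aB bB P (fun i => (a i : ℝ) / q + β i) *
                eC (-(∑ i, ((a i : ℝ) / q + β i) * (ν i : ℝ))) -
              (P : ℂ) ^ n * ((q : ℂ) ^ n)⁻¹ * SgaussNu f q a ν *
                Iosc (fun i => MvPolynomial.homogeneousComponent d (f i)) (boxSet aB bB)
                  (fun i => P ^ d * β i) * eC (-(∑ i, β i * (ν i : ℝ)))‖ ≤
            c * C * Ct ^ (R - 1) * P ^ ((n : ℝ) + (R : ℝ) * ((d : ℝ) - 1) * θ₀ - 1) := by
  classical
  refine ⟨3 ^ n * Real.pi * R * (expBox n d).card +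
        4 ^ n * (Real.pi * R * (expBox n d).card * d * 2 ^ d) + 2 * n * 4 ^ n, ?_, ?_⟩
  · have : (0:ℝ) < n := by exact_mod_cast (by omega : 0 < n)
    have := Real.pi_pos
    positivity
  intro f hf aB bB hB C Ct K hC1 hCt1 hC hCt _ θ₀ δ hθ hδ P hP hlog _ ν q a β hq hqU _ _ hβ
  set η : ℝ := (R : ℝ) * ((d : ℝ) - 1) * θ₀ with hη
  have hP0 : 0 < P := by linarith
  have hlP : 0 < Real.log P := Real.log_pos (by linarith)
  set A : ℝ := Ct ^ (R - 1) * P ^ η with hA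
  have hA0 : 0 ≤ A := by positivity
  have hCtA : Ct ^ R * P ^ η = Ct * A := by
    have : Ct ^ R = Ct * Ct ^ (R - 1) := by rw [← pow_succ']; congr 1; omega
    rw [hA, this]; ring
  have hqA : (q : ℝ) ≤ Ct * A := by rw [← hCtA]; exact hqU
  have hqP : (q : ℝ) ≤ P := by
    refine hqU.trans ?_
    rw [← Real.log_le_log_iff (by positivity) hP0, Real.log_mul (by positivity) (by positivity),
      Real.log_pow, Real.log_rpow hP0]
    have h := mul_lt_mul_of_pos_right hlog hlP
    rw [add_mul, div_mul_cancel₀ _ hlP.ne', one_mul] at h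
    linarith
  have hC' : ∀ i m, |(((f i).coeff m : ℤ) : ℝ)| ≤ C := fun i m => hC.2 ⟨i, m, rfl⟩
  have hCt' : ∀ i m, |(((MvPolynomial.homogeneousComponent d (f i)).coeff m : ℤ) : ℝ)| ≤ Ct :=
    fun i m => hCt.2 ⟨i, m, rfl⟩
  have hCC : Ct ≤ C := by
    obtain ⟨i, m, h⟩ := hCt.1
    rw [h, MvPolynomial.coeff_homogeneousComponent]
    split_ifs
    · exact hC' i m
    · simp; linarith
  have hβ' : ∀ i, |β i| ≤ A / (2 * q * P ^ d) := by
    intro i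
    refine (hβ i).trans (le_of_eq ?_)
    have hq0 : (q : ℝ) ≠ 0 := by positivity
    rw [Real.rpow_add hP0, Real.rpow_neg hP0.le, Real.rpow_natCast, hA]
    field_simp
  have key := main_est n R d (by omega) f hf aB bB
    (fun j => ⟨(hB j).1, by linarith [(hB j).2.1], (hB j).2.2.2⟩) C Ct A P (by linarith) hCC hA0
    (by linarith) hC' hCt' q hq hqP hqA a β hβ'
  have e1 : P ^ ((n : ℝ) + η - 1) = P ^ η * (P ^ n / P) := by
    rw [Real.rpow_sub hP0, Real.rpow_add hP0, Real.rpow_natCast, Real.rpow_one]; ring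
  rw [e1]
  have e2 : eC (-(∑ i, ((a i : ℝ) / q + β i) * (ν i : ℝ))) =
      eC (-(∑ i, (a i : ℝ) * (ν i : ℝ)) / q) * eC (-(∑ i, β i * (ν i : ℝ))) := by
    rw [← eC_add]
    congr 1
    rw [neg_div, ← neg_add, Finset.sum_div, ← Finset.sum_add_distrib]
    congr 1
    refine Finset.sum_congr rfl fun i _ => ?_
    ring
  have e3 : ∀ s t p m g u v : ℂ, s * (u * v) - p * m * (g * u) * t * v =
      (s - p * m * g * t) * (u * v) := by intros; ring
  rw [SgaussNu, e2, e3, norm_mul, norm_mul, eC_norm, eC_norm, mul_one, mul_one]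
  refine key.trans (le_of_eq ?_)
  rw [hA]; ring

end
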